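/- Let n ≥ 1 and let a_0, a_1, …, a_n be independent standard normal random variables. Then for every t ≥ 0, the probability that a_n ≠ 0 and max_{0 ≤ i ≤ n-1} |a_i / a_n| ≤ t is at least ((2/π) arctan t)^n. -/

import Mathlib

open MeasureTheory ProbabilityTheory

lemma integral_abs_mul_exp_neg_mul_sq {b : ℝ} (hb : 0 < b) :
    ∫ y : ℝ, |y| * Real.exp (-b * y ^ 2) = 1 / b := by
  have h := integral_comp_abs (f := fun y : ℝ => y * Real.exp (-b * y ^ 2))
  simp only [sq_abs] at h
  rw [h]
  have h2 := integral_rpow_mul_exp_neg_mul_rpow (p := 2) (q := 1) (b := b) (by norm_num) (by norm_num) hb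
  norm_num [Real.rpow_neg_one] at h2
  simp only [neg_mul]
  rw [h2]
  field_simp

lemma gaussianPDFReal_mul_gaussianPDFReal (u : ℝ) {y : ℝ} (hy : y ≠ 0) :
    gaussianPDFReal 0 1 y * gaussianPDFReal 0 (1 / .mk (y ^ 2) (sq_nonneg y)) u =
      (2 * Real.pi)⁻¹ * (|y| * Real.exp (-((1 + u ^ 2) / 2) * y ^ 2)) := by
  have h1 : √(2 * Real.pi) ^ 2 = 2 * Real.pi := Real.sq_sqrt (by positivity)
  have h2 : √(2 * Real.pi * (1 / y ^ 2)) = √(2 * Real.pi) / |y| := by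
    rw [mul_one_div, Real.sqrt_div (by positivity), Real.sqrt_sq_eq_abs]
  have h3 : -((1 + u ^ 2) / 2) * y ^ 2 = -(y - 0) ^ 2 / (2 * 1) + -(u - 0) ^ 2 / (2 * (1 / y ^ 2)) := by
    field_simp
    ring
  simp only [gaussianPDFReal, NNReal.coe_div, NNReal.coe_one, NNReal.coe_mk]
  have : 0 < √(2 * Real.pi) := by positivity
  rw [h2, h3, Real.exp_add, mul_one]
  nth_rewrite 3 [← h1]
  field_simp

lemma measurable_gaussianPDF_inv_sq {α : Type*} [MeasurableSpace α] {f g : α → ℝ}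
    (hf : Measurable f) (hg : Measurable g) :
    Measurable fun a => gaussianPDF 0 (1 / .mk (f a ^ 2) (sq_nonneg (f a))) (g a) := by
  have : Measurable fun a => (1 / .mk (f a ^ 2) (sq_nonneg (f a)) : NNReal) :=
    measurable_const.div (Measurable.subtype_mk (by fun_prop))
  exact measurable_uncurry_gaussianPDF.comp (measurable_const.prodMk (this.prodMk hg))

lemma lintegral_gaussianPDF_inv_sq (u : ℝ) :
    ∫⁻ y, gaussianPDF 0 (1 / .mk (y ^ 2) (sq_nonneg y)) u ∂(gaussianReal 0 1) =
      ENNReal.ofReal (Real.pi⁻¹ * (1 + u ^ 2)⁻¹) := by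
  have hb : 0 < (1 + u ^ 2) / 2 := by positivity
  have hm : Measurable fun y : ℝ => gaussianPDF 0 (1 / .mk (y ^ 2) (sq_nonneg y)) u :=
    measurable_gaussianPDF_inv_sq measurable_id measurable_const
  rw [gaussianReal_of_var_ne_zero _ one_ne_zero,
    lintegral_withDensity_eq_lintegral_mul _ (measurable_gaussianPDF _ _) hm]
  have hi : Integrable fun y : ℝ => |y| * Real.exp (-((1 + u ^ 2) / 2) * y ^ 2) := by
    simpa [abs_mul] using (integrable_mul_exp_neg_mul_sq hb).abs
  calc _ = ∫⁻ y : ℝ, ENNReal.ofReal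
        ((2 * Real.pi)⁻¹ * (|y| * Real.exp (-((1 + u ^ 2) / 2) * y ^ 2))) := by
        refine lintegral_congr_ae ?_
        filter_upwards [Measure.ae_ne volume (0 : ℝ)] with y hy
        rw [← gaussianPDFReal_mul_gaussianPDFReal u hy,
          ENNReal.ofReal_mul (gaussianPDFReal_nonneg _ _ _), Pi.mul_apply, gaussianPDF, gaussianPDF]
    _ = _ := by
        rw [← ofReal_integral_eq_lintegral_ofReal (hi.const_mul _)
          (ae_of_all _ fun y => by positivity), integral_const_mul,
          integral_abs_mul_exp_neg_mul_sq hb]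
        congr 1
        field_simp

lemma gaussianReal_abs_div_le {y : ℝ} (hy : y ≠ 0) (t : ℝ) :
    gaussianReal 0 1 {x | |x / y| ≤ t} =
      ∫⁻ u in Set.Icc (-t) t, gaussianPDF 0 (1 / .mk (y ^ 2) (sq_nonneg y)) u := by
  have hv : (1 / .mk (y ^ 2) (sq_nonneg y) : NNReal) ≠ 0 := by
    refine div_ne_zero one_ne_zero fun h => hy ?_
    simpa using congrArg NNReal.toReal h
  have h := gaussianReal_map_div_const (μ := 0) (v := 1) y
  rw [zero_div] at h
  rw [← gaussianReal_apply _ hv, ← h, Measure.map_apply (by fun_prop) measurableSet_Icc]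
  congr 1
  ext x
  simp [abs_le]

/-- If `x` and `y` are independent standard normal variables, then `|x / y| ≤ t` has probability
`(2/π) arctan t`. -/
lemma lintegral_gaussianReal_abs_div_le {t : ℝ} (ht : 0 ≤ t) :
    ∫⁻ y, gaussianReal 0 1 {x | |x / y| ≤ t} ∂(gaussianReal 0 1) =
      ENNReal.ofReal ((2 / Real.pi) * Real.arctan t) := by
  have := nullSingletonClass_gaussianReal (μ := 0) (v := 1) one_ne_zero
  calc _ = ∫⁻ y, (∫⁻ u in Set.Icc (-t) t, gaussianPDF 0 (1 / .mk (y ^ 2) (sq_nonneg y)) u)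
          ∂(gaussianReal 0 1) := by
        refine lintegral_congr_ae ?_
        filter_upwards [Measure.ae_ne (gaussianReal 0 1) (0 : ℝ)] with y hy
        exact gaussianReal_abs_div_le hy t
    _ = ∫⁻ u in Set.Icc (-t) t, ENNReal.ofReal (Real.pi⁻¹ * (1 + u ^ 2)⁻¹) := by
        rw [lintegral_lintegral_swap (measurable_gaussianPDF_inv_sq measurable_fst measurable_snd).aemeasurable]
        simp_rw [lintegral_gaussianPDF_inv_sq]
    _ = _ := by
        rw [← ofReal_integral_eq_lintegral_ofReal
          ((integrable_inv_one_add_sq.const_mul _).integrableOn)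
          (ae_of_all _ fun u => by positivity), integral_const_mul, integral_Icc_eq_integral_Ioc,
          ← intervalIntegral.integral_of_le (by linarith), integral_inv_one_add_sq,
          Real.arctan_neg]
        congr 1
        ring

lemma measurable_gaussianReal_abs_div_le (t : ℝ) :
    Measurable fun y : ℝ => gaussianReal 0 1 {x | |x / y| ≤ t} :=
  measurable_measure_prodMk_left (ν := gaussianReal 0 1) (s := {p : ℝ × ℝ | |p.2 / p.1| ≤ t})
    (measurableSet_le (by fun_prop) measurable_const)

/-- Jensen's inequality for powers of a function with values in `[0, 1]`. -/
lemma pow_lintegral_le_lintegral_pow {Ω : Type*} [MeasurableSpace Ω] {P : Measure Ω}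
    [IsProbabilityMeasure P] {f : Ω → ENNReal} (hf : Measurable f) (hf1 : ∀ ω, f ω ≤ 1) (n : ℕ) :
    (∫⁻ ω, f ω ∂P) ^ n ≤ ∫⁻ ω, f ω ^ n ∂P := by
  have hfin : ∀ n ω, f ω ^ n ≠ ⊤ := fun n ω => by
    have := hf1 ω
    exact ENNReal.pow_ne_top (ne_top_of_le_ne_top ENNReal.one_ne_top this)
  have hint : ∀ n, Integrable (fun ω => (f ω ^ n).toReal) P := fun n =>
    integrable_toReal_of_lintegral_ne_top (hf.pow_const n).aemeasurable <|
      ne_top_of_le_ne_top ENNReal.one_ne_top <|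
        (lintegral_mono fun ω => pow_le_one₀ (zero_le) (hf1 ω)).trans (by simp)
  have key := (convexOn_pow n).map_integral_le (μ := P) (f := fun ω => (f ω).toReal)
    (continuous_pow n).continuousOn isClosed_Ici (ae_of_all _ fun ω => ENNReal.toReal_nonneg)
    (by simpa using hint 1) (by simpa [Function.comp_def] using hint n)
  have h1 : ∫⁻ ω, f ω ∂P = ENNReal.ofReal (∫ ω, (f ω).toReal ∂P) := by
    rw [ofReal_integral_eq_lintegral_ofReal (by simpa using hint 1)
      (ae_of_all _ fun ω => ENNReal.toReal_nonneg)]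
    exact lintegral_congr fun ω => (ENNReal.ofReal_toReal (by simpa using hfin 1 ω)).symm
  have h2 : ∫⁻ ω, f ω ^ n ∂P = ENNReal.ofReal (∫ ω, (f ω ^ n).toReal ∂P) := by
    rw [ofReal_integral_eq_lintegral_ofReal (hint n) (ae_of_all _ fun ω => ENNReal.toReal_nonneg)]
    exact lintegral_congr fun ω => (ENNReal.ofReal_toReal (hfin n ω)).symm
  rw [h1, h2, ← ENNReal.ofReal_pow (integral_nonneg fun ω => ENNReal.toReal_nonneg)]
  simp only [ENNReal.toReal_pow]
  exact ENNReal.ofReal_le_ofReal key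

lemma pi_gaussianReal_abs_div_last_le (n : ℕ) (t : ℝ) :
    (Measure.pi fun _ : Fin (n + 1) => gaussianReal 0 1)
        {a | a (Fin.last n) ≠ 0 ∧ ∀ i : Fin n, |a i.castSucc / a (Fin.last n)| ≤ t} =
      ∫⁻ y, gaussianReal 0 1 {x | |x / y| ≤ t} ^ n ∂(gaussianReal 0 1) := by
  have := nullSingletonClass_gaussianReal (μ := 0) (v := 1) one_ne_zero
  have hS : MeasurableSet {p : ℝ × (Fin n → ℝ) | p.1 ≠ 0 ∧ ∀ i, |p.2 i / p.1| ≤ t} := by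
    simp only [Set.ofPred_and, Set.ofPred_forall]
    exact (measurable_fst (measurableSet_singleton (0 : ℝ)).compl).inter <|
      MeasurableSet.iInter fun i => measurableSet_le (by fun_prop) measurable_const
  have hmp := measurePreserving_piFinSuccAbove
    (fun _ : Fin (n + 1) => gaussianReal 0 1) (Fin.last n)
  have hpre : {a : Fin (n + 1) → ℝ | a (Fin.last n) ≠ 0 ∧
      ∀ i : Fin n, |a i.castSucc / a (Fin.last n)| ≤ t} =
      MeasurableEquiv.piFinSuccAbove (fun _ : Fin (n + 1) => ℝ) (Fin.last n) ⁻¹'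
        {p : ℝ × (Fin n → ℝ) | p.1 ≠ 0 ∧ ∀ i, |p.2 i / p.1| ≤ t} := by
    ext a
    simp [MeasurableEquiv.piFinSuccAbove, Fin.init]
  rw [hpre, hmp.measure_preimage hS.nullMeasurableSet, Measure.prod_apply hS]
  refine lintegral_congr_ae ?_
  filter_upwards [Measure.ae_ne (gaussianReal 0 1) (0 : ℝ)] with y hy
  have : Prod.mk y ⁻¹' {p : ℝ × (Fin n → ℝ) | p.1 ≠ 0 ∧ ∀ i, |p.2 i / p.1| ≤ t} =
      Set.univ.pi fun _ => {x | |x / y| ≤ t} := by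
    ext b
    simp [hy]
  rw [this, Measure.pi_pi]
  simp

/-- If `a_0, …, a_n` are independent standard normal random variables
(`n ≥ 1`), then for every `t ≥ 0`, the probability that `a_n ≠ 0` and
`max_{0 ≤ i ≤ n-1} |a_i / a_n| ≤ t` is at least `((2/π) arctan t)^n`. -/
theorem prob_max_abs_ratio_le_ge (n : ℕ) (hn : 1 ≤ n) (t : ℝ) (ht : 0 ≤ t) :
    ((2 / Real.pi) * Real.arctan t) ^ n ≤
      ((Measure.pi fun _ : Fin (n + 1) => gaussianReal 0 1)
        {a : Fin (n + 1) → ℝ | a (Fin.last n) ≠ 0 ∧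
          Finset.univ.sup'
            (Finset.univ_nonempty_iff.mpr (Fin.pos_iff_nonempty.mp hn))
            (fun i : Fin n => |a i.castSucc / a (Fin.last n)|) ≤ t}).toReal := by
  have hc : 0 ≤ (2 / Real.pi) * Real.arctan t :=
    mul_nonneg (by positivity) (Real.arctan_nonneg.mpr ht)
  refine (ENNReal.ofReal_le_iff_le_toReal (measure_ne_top _ _)).mp ?_
  simp only [Finset.sup'_le_iff, Finset.mem_univ, forall_const]
  rw [ENNReal.ofReal_pow hc, pi_gaussianReal_abs_div_last_le,
    ← lintegral_gaussianReal_abs_div_le ht]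
  exact pow_lintegral_le_lintegral_pow (measurable_gaussianReal_abs_div_le t)
    (fun _ => prob_le_one) n
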